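/- For each k ≥ 1, let g_n^{(k)} denote the number of λυ-terms of size n that ψ-normalise in exactly k normal-order ψ-reduction steps, and let G_k(z) = ∑_n g_n^{(k)} z^n. Then G_k(z) can be represented as G_k(z) = √(1 − 4z)·P(z) + Q(z), where P and Q are functions analytic in the open disc |z| < 1/4 + ε for some ε > 0; in particular, G_k(z) is analytic at 0 with a unique dominant singularity at z = 1/4 of square-root type. -/

import Mathlib

mutual
/-- λυ-terms in de Bruijn notation, with explicit closures. -/
inductive LTerm : Type
  | idx : Nat → LTerm
  | lam : LTerm → LTerm
  | app : LTerm → LTerm → LTerm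
  | clos : LTerm → LSub → LTerm
  deriving DecidableEq

/-- explicit λυ-substitutions. -/
inductive LSub : Type
  | slash : LTerm → LSub
  | lift : LSub → LSub
  | shift : LSub
  deriving DecidableEq
end

mutual
/-- natural size of a λυ-term: the number of constructors (|idx n| = n+1). -/
def LTerm.size : LTerm → Nat
  | .idx n => n + 1
  | .lam a => 1 + a.size
  | .app a b => 1 + a.size + b.size
  | .clos a s => 1 + a.size + s.size

/-- natural size of a substitution. -/
def LSub.size : LSub → Nat
  | .slash a => 1 + a.size
  | .lift s => 1 + s.size
  | .shift => 1
end

/-- a λυ-term is pure if it contains no closure; pure terms are exactly the ψ-normal forms. -/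
def LTerm.IsPure : LTerm → Prop
  | .idx _ => True
  | .lam a => a.IsPure
  | .app a b => a.IsPure ∧ b.IsPure
  | .clos _ _ => False

/-- one normal-order (leftmost-outermost) ψ-reduction step. -/
inductive NStep : LTerm → LTerm → Prop
  /-- (App) (ab)[s] → a[s](b[s]) -/
  | appS (a b : LTerm) (s : LSub) :
      NStep (.clos (.app a b) s) (.app (.clos a s) (.clos b s))
  /-- (Lambda) (λa)[s] → λ(a[⇑(s)]) -/
  | lamS (a : LTerm) (s : LSub) :
      NStep (.clos (.lam a) s) (.lam (.clos a (.lift s)))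
  /-- (FVar) 0[a/] → a -/
  | fvar (a : LTerm) : NStep (.clos (.idx 0) (.slash a)) a
  /-- (RVar) (S n)[a/] → n -/
  | rvar (n : Nat) (a : LTerm) : NStep (.clos (.idx (n+1)) (.slash a)) (.idx n)
  /-- (FVarLift) 0[⇑(s)] → 0 -/
  | fvarLift (s : LSub) : NStep (.clos (.idx 0) (.lift s)) (.idx 0)
  /-- (RVarLift) (S n)[⇑(s)] → n[s][↑] -/
  | rvarLift (n : Nat) (s : LSub) :
      NStep (.clos (.idx (n+1)) (.lift s)) (.clos (.clos (.idx n) s) .shift)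
  /-- (VarShift) n[↑] → S n -/
  | varShift (n : Nat) : NStep (.clos (.idx n) .shift) (.idx (n+1))
  /-- reduce under an abstraction -/
  | lamCong {a a' : LTerm} : NStep a a' → NStep (.lam a) (.lam a')
  /-- reduce in the left part of an application -/
  | appLeft {a a' : LTerm} (b : LTerm) : NStep a a' → NStep (.app a b) (.app a' b)
  /-- reduce in the right part of an application, provided the left part is normal -/
  | appRight {b b' : LTerm} (a : LTerm) :
      a.IsPure → NStep b b' → NStep (.app a b) (.app a b')
  /-- reduce in the body of a closure, provided the closure is not itself a ψ-redex,
      i.e. its body is again a closure -/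
  | closCong {t t' : LTerm} (s : LSub) :
      (∃ u v, t = LTerm.clos u v) → NStep t t' → NStep (.clos t s) (.clos t' s)

/-- `NormIn t k` : `t` reaches its ψ-normal form in exactly `k` normal-order
ψ-reduction steps (written t ↓_k). -/
inductive NormIn : LTerm → Nat → Prop
  | base {t : LTerm} : t.IsPure → NormIn t 0
  | step {t t' : LTerm} {k : Nat} : NStep t t' → NormIn t' k → NormIn t (k+1)

/-- the number g_n^{(k)} of λυ-terms of size n that ψ-normalise in exactly k
normal-order ψ-reduction steps. -/
noncomputable def normCount (k n : ℕ) : ℕ :=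
  Nat.card {t : LTerm // t.size = n ∧ NormIn t k}


/-- One normal-order step as a function, meaningful on closures only. -/
def LTerm.contract : LTerm → LTerm
  | .clos (.app a b) s => .app (.clos a s) (.clos b s)
  | .clos (.lam a) s => .lam (.clos a (.lift s))
  | .clos (.idx 0) (.slash a) => a
  | .clos (.idx (n + 1)) (.slash _) => .idx n
  | .clos (.idx 0) (.lift _) => .idx 0
  | .clos (.idx (n + 1)) (.lift s) => .clos (.clos (.idx n) s) .shift
  | .clos (.idx n) .shift => .idx (n + 1)
  | .clos (.clos u v) s => .clos (LTerm.contract (.clos u v)) s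
  | t => t

theorem NStep.not_isPure {t t' : LTerm} (h : NStep t t') : ¬ t.IsPure := by
  induction h <;> simp_all [LTerm.IsPure]

theorem NStep.deterministic {t t₁ t₂ : LTerm} (h₁ : NStep t t₁) (h₂ : NStep t t₂) :
    t₁ = t₂ := by
  induction h₁ generalizing t₂ with
  | lamCong _ ih => cases h₂ with | lamCong h => rw [ih h]
  | appLeft b h ih =>
    cases h₂ with
    | appLeft _ h' => rw [ih h']
    | appRight _ hp _ => exact absurd hp h.not_isPure
  | appRight a hp h ih =>
    cases h₂ with
    | appLeft _ h' => exact absurd hp h'.not_isPure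
    | appRight _ _ h' => rw [ih h']
  | closCong s hc h ih =>
    obtain ⟨u, v, rfl⟩ := hc
    cases h₂ with
    | closCong _ _ h' => rw [ih h']
  | _ => cases h₂ <;> simp_all

theorem NStep.contract (u : LTerm) (v : LSub) :
    NStep (.clos u v) (LTerm.contract (.clos u v)) := by
  match u, v with
  | .app a b, s => exact .appS a b s
  | .lam a, s => exact .lamS a s
  | .idx 0, .slash a => exact .fvar a
  | .idx (n + 1), .slash a => exact .rvar n a
  | .idx 0, .lift s => exact .fvarLift s
  | .idx (n + 1), .lift s => exact .rvarLift n s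
  | .idx 0, .shift => exact .varShift 0
  | .idx (n + 1), .shift => exact .varShift (n + 1)
  | .clos x y, s => exact .closCong s ⟨x, y, rfl⟩ (NStep.contract x y)

theorem normIn_zero {t : LTerm} : NormIn t 0 ↔ t.IsPure :=
  ⟨fun h => by cases h; assumption, .base⟩

theorem NStep.normIn_iff {t t' : LTerm} (h : NStep t t') (k : ℕ) :
    NormIn t (k + 1) ↔ NormIn t' k :=
  ⟨fun hn => by cases hn with | step h' hn => rwa [h.deterministic h'], .step h⟩

theorem NormIn.unique {t : LTerm} {j k : ℕ} (hj : NormIn t j) (hk : NormIn t k) : j = k := by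
  induction hj generalizing k with
  | base hp =>
    cases hk with
    | base => rfl
    | step h _ => exact absurd hp h.not_isPure
  | step h _ ih =>
    cases hk with
    | base hp => exact absurd hp h.not_isPure
    | step h' hn => rw [ih (h.deterministic h' ▸ hn)]

theorem normIn_idx (n k : ℕ) : NormIn (.idx n) k ↔ k = 0 := by
  refine ⟨fun h => ?_, fun h => h ▸ .base trivial⟩
  cases h with
  | base => rfl
  | step h _ => cases h

theorem normIn_lam (a : LTerm) (k : ℕ) : NormIn (.lam a) k ↔ NormIn a k := by
  constructor
  · intro h
    generalize ht : LTerm.lam a = t at h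
    induction h generalizing a with
    | base hp => subst ht; exact .base hp
    | step h _ ih =>
      subst ht
      cases h with | lamCong h => exact .step h (ih _ rfl)
  · intro h
    induction h with
    | base hp => exact .base hp
    | step h _ ih => exact .step (.lamCong h) ih

theorem normIn_app (a b : LTerm) (k : ℕ) :
    NormIn (.app a b) k ↔ ∃ i j, i + j = k ∧ NormIn a i ∧ NormIn b j := by
  constructor
  · intro h
    generalize ht : LTerm.app a b = t at h
    induction h generalizing a b with
    | base hp => subst ht; exact ⟨0, 0, rfl, .base hp.1, .base hp.2⟩
    | step h _ ih =>
      subst ht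
      cases h with
      | appLeft _ h =>
        obtain ⟨i, j, rfl, hi, hj⟩ := ih _ _ rfl
        exact ⟨i + 1, j, by omega, .step h hi, hj⟩
      | appRight _ hp h =>
        obtain ⟨i, j, rfl, hi, hj⟩ := ih _ _ rfl
        exact ⟨i, j + 1, rfl, hi, .step h hj⟩
  · rintro ⟨i, j, rfl, hi, hj⟩
    induction hi with
    | base hp =>
      rw [Nat.zero_add]
      induction hj with
      | base hq => exact .base ⟨hp, hq⟩
      | step h _ ih => exact .step (.appRight _ hp h) ih
    | step h _ ih => rw [Nat.add_right_comm]; exact .step (.appLeft _ h) ih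

open Classical in
/-- The indicator of the terms that normalise in exactly `k` steps. -/
noncomputable def normInd (k : ℕ) : LTerm ⊕ LSub → ℂ
  | .inl t => if NormIn t k then 1 else 0
  | .inr _ => 0

theorem normInd_idx (k n : ℕ) : normInd k (.inl (.idx n)) = if k = 0 then 1 else 0 := by
  simp [normInd, normIn_idx]

theorem normInd_lam (k : ℕ) (a : LTerm) : normInd k (.inl (.lam a)) = normInd k (.inl a) := by
  simp only [normInd]
  classical exact if_congr (normIn_lam a k) rfl rfl

theorem normInd_app (k : ℕ) (a b : LTerm) : normInd k (.inl (.app a b)) =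
    ∑ x ∈ Finset.HasAntidiagonal.antidiagonal k, normInd x.1 (.inl a) * normInd x.2 (.inl b) := by
  classical
  by_cases h : NormIn (.app a b) k
  · obtain ⟨i, j, hij, hi, hj⟩ := (normIn_app a b k).1 h
    rw [Finset.sum_eq_single (i, j)]
    · simp [normInd, h, hi, hj]
    · rintro ⟨i', j'⟩ - hne
      by_contra hc
      simp only [normInd, mul_ite, mul_one, mul_zero, ite_eq_right_iff, not_forall] at hc
      have hi' : NormIn a i' := by by_contra h0; simp [h0] at hc
      exact hne (by rw [hi.unique hi', hj.unique hc.1])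
    · simp [hij]
  · rw [Finset.sum_eq_zero]
    · simp [normInd, h]
    · rintro ⟨i, j⟩ hij
      rw [Finset.HasAntidiagonal.mem_antidiagonal] at hij
      by_cases hi : NormIn a i
      · have hj : ¬ NormIn b j := fun hj => h ((normIn_app a b k).2 ⟨i, j, hij, hi, hj⟩)
        simp [normInd, hj]
      · simp [normInd, hi]

theorem normInd_zero_clos (u : LTerm) (v : LSub) : normInd 0 (.inl (.clos u v)) = 0 := by
  simp [normInd, normIn_zero, LTerm.IsPure]

theorem normInd_succ_clos (k : ℕ) (u : LTerm) (v : LSub) :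
    normInd (k + 1) (.inl (.clos u v)) = normInd k (.inl (LTerm.contract (.clos u v))) := by
  simp only [normInd]
  classical exact if_congr ((NStep.contract u v).normIn_iff k) rfl rfl

theorem normInd_mul_self (k : ℕ) : normInd k * normInd k = normInd k := by
  funext x
  rcases x with t | s <;> simp [normInd]

theorem normInd_mul_of_ne {j k : ℕ} (h : j ≠ k) : normInd j * normInd k = 0 := by
  funext x
  rcases x with t | s
  · by_cases hj : NormIn t j
    · have hk : ¬ NormIn t k := fun hk => h (hj.unique hk)
      simp [normInd, hk]
    · simp [normInd, hj]
  · simp [normInd]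

/-- The weight equal to `u` on indices and vanishing elsewhere. -/
def idxW (u : ℕ → ℂ) : LTerm ⊕ LSub → ℂ
  | .inl (.idx n) => u n
  | _ => 0

/-- The weight induced by `f` on abstractions. -/
def lamW (f : LTerm ⊕ LSub → ℂ) : LTerm ⊕ LSub → ℂ
  | .inl (.lam a) => f (.inl a)
  | _ => 0

/-- The weight equal to `h` on applications and vanishing elsewhere. -/
def appW (h : LTerm → LTerm → ℂ) : LTerm ⊕ LSub → ℂ
  | .inl (.app a b) => h a b
  | _ => 0

/-- The weight equal to `h` on closures and vanishing elsewhere. -/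
def closW (h : LTerm → LSub → ℂ) : LTerm ⊕ LSub → ℂ
  | .inl (.clos a s) => h a s
  | _ => 0

/-- The weight induced by `f` on substitutions `a/`. -/
def slashW (f : LTerm ⊕ LSub → ℂ) : LTerm ⊕ LSub → ℂ
  | .inr (.slash a) => f (.inl a)
  | _ => 0

/-- The weight induced by `f` on lifted substitutions. -/
def liftW (f : LTerm ⊕ LSub → ℂ) : LTerm ⊕ LSub → ℂ
  | .inr (.lift s) => f (.inr s)
  | _ => 0

/-- The weight equal to `c` on the shift and vanishing elsewhere. -/
def shiftW (c : ℂ) : LTerm ⊕ LSub → ℂ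
  | .inr .shift => c
  | _ => 0

/-- Weights given by finite sums of tree patterns, whose leaves are arbitrary nodes or terms
with a prescribed normalisation cost. -/
inductive Pattern : (LTerm ⊕ LSub → ℂ) → Prop
  | one : Pattern 1
  | add {f g : LTerm ⊕ LSub → ℂ} : Pattern f → Pattern g → Pattern (f + g)
  | idx {u : ℕ → ℂ} {C : ℝ} (hu : ∀ n, ‖u n‖ ≤ C) : Pattern (idxW u)
  | lam {f : LTerm ⊕ LSub → ℂ} : Pattern f → Pattern (lamW f)
  | app {f g : LTerm ⊕ LSub → ℂ} : Pattern f → Pattern g →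
      Pattern (appW fun a b => f (.inl a) * g (.inl b))
  | clos {f g : LTerm ⊕ LSub → ℂ} : Pattern f → Pattern g →
      Pattern (closW fun a s => f (.inl a) * g (.inr s))
  | slash {f : LTerm ⊕ LSub → ℂ} : Pattern f → Pattern (slashW f)
  | lift {f : LTerm ⊕ LSub → ℂ} : Pattern f → Pattern (liftW f)
  | shift (c : ℂ) : Pattern (shiftW c)
  | norm (k : ℕ) (n : ℕ → ℕ) (p q : ℕ → ℕ → LTerm ⊕ LSub → ℂ)
      (hp : ∀ j l, Pattern (p j l)) (hq : ∀ j l, Pattern (q j l))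
      (h : ∀ j ≤ k, ∀ u v, normInd j (.inl (.clos u v)) =
        ∑ l ∈ Finset.range (n j), p j l (.inl u) * q j l (.inr v)) : Pattern (normInd k)

/-- The restrictions of patterns to terms. -/
def TermPattern (f : LTerm → ℂ) : Prop := ∃ g, Pattern g ∧ ∀ t, f t = g (.inl t)

/-- The restrictions of patterns to substitutions. -/
def SubPattern (f : LSub → ℂ) : Prop := ∃ g, Pattern g ∧ ∀ s, f s = g (.inr s)

/-- Finite sums of products of a function in `A` and a function in `B`. -/
inductive Tens {α β : Type} (A : (α → ℂ) → Prop) (B : (β → ℂ) → Prop) : (α → β → ℂ) → Prop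
  | zero : Tens A B 0
  | add {h₁ h₂ : α → β → ℂ} : Tens A B h₁ → Tens A B h₂ → Tens A B (h₁ + h₂)
  | mul {f : α → ℂ} {g : β → ℂ} : A f → B g → Tens A B (fun a b => f a * g b)

namespace Pattern

variable {f g : LTerm ⊕ LSub → ℂ}

theorem zero : Pattern 0 := by
  have h : Pattern (idxW fun _ => 0) := .idx (C := 0) (by simp)
  convert h using 1
  funext x
  rcases x with (_ | _ | _ | _) | (_ | _ | _) <;> rfl

theorem norm_of_le {k : ℕ} {n : ℕ → ℕ} {p q : ℕ → ℕ → LTerm ⊕ LSub → ℂ}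
    (hp : ∀ j l, Pattern (p j l)) (hq : ∀ j l, Pattern (q j l))
    (h : ∀ j ≤ k, ∀ u v, normInd j (.inl (.clos u v)) =
        ∑ l ∈ Finset.range (n j), p j l (.inl u) * q j l (.inr v)) {j : ℕ} (hj : j ≤ k) :
    Pattern (normInd j) :=
  .norm j n p q hp hq fun i hi => h i (hi.trans hj)

theorem bounded (hf : Pattern f) : ∃ C : ℝ, ∀ x, ‖f x‖ ≤ C := by
  induction hf with
  | one => exact ⟨1, by simp⟩
  | add _ _ ih₁ ih₂ =>
    obtain ⟨C, hC⟩ := ih₁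
    obtain ⟨D, hD⟩ := ih₂
    exact ⟨C + D, fun x => (norm_add_le _ _).trans (add_le_add (hC x) (hD x))⟩
  | @idx u C hu =>
    have h0 := (norm_nonneg _).trans (hu 0)
    refine ⟨C, fun x => ?_⟩
    rcases x with (_ | _ | _ | _) | (_ | _ | _) <;> simp [idxW, hu, h0]
  | lam _ ih | slash _ ih | lift _ ih =>
    obtain ⟨C, hC⟩ := ih
    have h0 := (norm_nonneg _).trans (hC (.inr .shift))
    refine ⟨C, fun x => ?_⟩
    rcases x with (_ | _ | _ | _) | (_ | _ | _) <;> simp [lamW, slashW, liftW, hC, h0]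
  | app _ _ ih₁ ih₂ | clos _ _ ih₁ ih₂ =>
    obtain ⟨C, hC⟩ := ih₁
    obtain ⟨D, hD⟩ := ih₂
    have h0 := (norm_nonneg _).trans (hC (.inr .shift))
    have h1 := (norm_nonneg _).trans (hD (.inr .shift))
    refine ⟨C * D, fun x => ?_⟩
    rcases x with (_ | _ | _ | _) | (_ | _ | _) <;> simp [appW, closW, mul_nonneg, h0, h1]
    all_goals exact mul_le_mul (hC _) (hD _) (norm_nonneg _) h0
  | shift c =>
    refine ⟨‖c‖, fun x => ?_⟩
    rcases x with (_ | _ | _ | _) | (_ | _ | _) <;> simp [shiftW]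
  | norm k =>
    refine ⟨1, fun x => ?_⟩
    rcases x with t | s
    · by_cases h : NormIn t k <;> simp [normInd, h]
    · simp [normInd]

end Pattern

theorem TermPattern.zero : TermPattern 0 := ⟨0, .zero, fun _ => rfl⟩

theorem SubPattern.zero : SubPattern 0 := ⟨0, .zero, fun _ => rfl⟩

theorem TermPattern.add {f g : LTerm → ℂ} (hf : TermPattern f) (hg : TermPattern g) :
    TermPattern (f + g) := by
  obtain ⟨f', hf', ef⟩ := hf
  obtain ⟨g', hg', eg⟩ := hg
  exact ⟨f' + g', hf'.add hg', fun t => by simp [ef, eg]⟩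

theorem SubPattern.add {f g : LSub → ℂ} (hf : SubPattern f) (hg : SubPattern g) :
    SubPattern (f + g) := by
  obtain ⟨f', hf', ef⟩ := hf
  obtain ⟨g', hg', eg⟩ := hg
  exact ⟨f' + g', hf'.add hg', fun t => by simp [ef, eg]⟩

theorem Pattern.termPattern {f : LTerm ⊕ LSub → ℂ} (hf : Pattern f) :
    TermPattern fun t => f (.inl t) := ⟨f, hf, fun _ => rfl⟩

theorem Pattern.subPattern {f : LTerm ⊕ LSub → ℂ} (hf : Pattern f) :
    SubPattern fun s => f (.inr s) := ⟨f, hf, fun _ => rfl⟩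

namespace Tens

variable {α β : Type} {A : (α → ℂ) → Prop} {B : (β → ℂ) → Prop} {h h' : α → β → ℂ}

theorem congr (hh : Tens A B h) (e : ∀ a b, h' a b = h a b) : Tens A B h' := by
  have : h' = h := by funext a b; exact e a b
  exact this ▸ hh

theorem sum {ι : Type*} {s : Finset ι} {h : ι → α → β → ℂ}
    (hh : ∀ i ∈ s, Tens A B (h i)) : Tens A B (∑ i ∈ s, h i) :=
  Finset.sum_induction h (Tens A B) (fun _ _ => .add) .zero hh

end Tens

/-- A sum of products of patterns has the form required by `Pattern.norm`. -/
theorem Tens.exists_sum {h : LTerm → LSub → ℂ} (hh : Tens TermPattern SubPattern h) :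
    ∃ (n : ℕ) (p q : ℕ → LTerm ⊕ LSub → ℂ), (∀ l, Pattern (p l)) ∧ (∀ l, Pattern (q l)) ∧
      ∀ u v, h u v = ∑ l ∈ Finset.range n, p l (.inl u) * q l (.inr v) := by
  induction hh with
  | zero => exact ⟨0, 0, 0, fun _ => .zero, fun _ => .zero, by simp⟩
  | mul hf hg =>
    obtain ⟨f', hf', ef⟩ := hf
    obtain ⟨g', hg', eg⟩ := hg
    exact ⟨1, fun _ => f', fun _ => g', fun _ => hf', fun _ => hg', by simp [ef, eg]⟩
  | add _ _ ih₁ ih₂ =>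
    obtain ⟨n, p, q, hp, hq, e⟩ := ih₁
    obtain ⟨n', p', q', hp', hq', e'⟩ := ih₂
    refine ⟨n + n', fun l => if l < n then p l else p' (l - n),
      fun l => if l < n then q l else q' (l - n), fun l => ?_, fun l => ?_, fun u v => ?_⟩
    · dsimp only; split_ifs <;> simp [hp, hp']
    · dsimp only; split_ifs <;> simp [hq, hq']
    · rw [Finset.sum_range_add]
      simp only [Pi.add_apply, e, e']
      congr 1
      · refine Finset.sum_congr rfl fun l hl => ?_
        rw [Finset.mem_range] at hl
        simp [hl]
      · simp

/-- A pattern restricted to any given head constructor is again made of patterns. -/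
theorem Pattern.heads {f : LTerm ⊕ LSub → ℂ} (hf : Pattern f) :
    TermPattern (fun a => f (.inl (.lam a))) ∧
    Tens TermPattern TermPattern (fun a b => f (.inl (.app a b))) ∧
    Tens TermPattern SubPattern (fun a s => f (.inl (.clos a s))) ∧
    TermPattern (fun a => f (.inr (.slash a))) ∧
    SubPattern (fun s => f (.inr (.lift s))) := by
  induction hf with
  | one =>
    exact ⟨one.termPattern, (Tens.mul one.termPattern one.termPattern).congr (by simp),
      (Tens.mul one.termPattern one.subPattern).congr (by simp), one.termPattern,
      one.subPattern⟩
  | add _ _ ih₁ ih₂ =>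
    exact ⟨ih₁.1.add ih₂.1, ih₁.2.1.add ih₂.2.1, ih₁.2.2.1.add ih₂.2.2.1,
      ih₁.2.2.2.1.add ih₂.2.2.2.1, ih₁.2.2.2.2.add ih₂.2.2.2.2⟩
  | idx | shift => exact ⟨.zero, .zero, .zero, .zero, .zero⟩
  | lam hf => exact ⟨hf.termPattern, .zero, .zero, .zero, .zero⟩
  | app hf hg => exact ⟨.zero, .mul hf.termPattern hg.termPattern, .zero, .zero, .zero⟩
  | clos hf hg => exact ⟨.zero, .zero, .mul hf.termPattern hg.subPattern, .zero, .zero⟩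
  | slash hf => exact ⟨.zero, .zero, .zero, hf.termPattern, .zero⟩
  | lift hf => exact ⟨.zero, .zero, .zero, .zero, hf.subPattern⟩
  | norm k n p q hp hq h =>
    refine ⟨⟨normInd k, .norm k n p q hp hq h, normInd_lam k⟩, ?_, ?_, .zero, .zero⟩
    · refine (Tens.sum (s := Finset.HasAntidiagonal.antidiagonal k)
        (h := fun x a b => normInd x.1 (.inl a) * normInd x.2 (.inl b)) fun x hx => ?_).congr
        fun a b => ?_
      · rw [Finset.HasAntidiagonal.mem_antidiagonal] at hx
        exact .mul (norm_of_le hp hq h (by omega)).termPattern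
          (norm_of_le hp hq h (by omega)).termPattern
      · simp [normInd_app]
    · refine (Tens.sum (s := Finset.range (n k))
        (h := fun l u v => p k l (.inl u) * q k l (.inr v)) fun l _ =>
          .mul (hp k l).termPattern (hq k l).subPattern).congr fun a b => ?_
      simp [h k le_rfl]

theorem Pattern.mul_lam {f : LTerm ⊕ LSub → ℂ} (ih : ∀ g, Pattern g → Pattern (g * f))
    {p : LTerm ⊕ LSub → ℂ} (hp : Pattern p) : Pattern (p * lamW f) := by
  obtain ⟨g, hg, e⟩ := hp.heads.1
  convert (ih g hg).lam using 1
  funext x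
  rcases x with (_ | _ | _ | _) | (_ | _ | _) <;> simp [lamW, e]

theorem Pattern.mul_slash {f : LTerm ⊕ LSub → ℂ} (ih : ∀ g, Pattern g → Pattern (g * f))
    {p : LTerm ⊕ LSub → ℂ} (hp : Pattern p) : Pattern (p * slashW f) := by
  obtain ⟨g, hg, e⟩ := hp.heads.2.2.2.1
  convert (ih g hg).slash using 1
  funext x
  rcases x with (_ | _ | _ | _) | (_ | _ | _) <;> simp [slashW, e]

theorem Pattern.mul_lift {f : LTerm ⊕ LSub → ℂ} (ih : ∀ g, Pattern g → Pattern (g * f))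
    {p : LTerm ⊕ LSub → ℂ} (hp : Pattern p) : Pattern (p * liftW f) := by
  obtain ⟨g, hg, e⟩ := hp.heads.2.2.2.2
  convert (ih g hg).lift using 1
  funext x
  rcases x with (_ | _ | _ | _) | (_ | _ | _) <;> simp [liftW, e]

theorem Pattern.mul_idx {u : ℕ → ℂ} {C : ℝ} (hu : ∀ n, ‖u n‖ ≤ C)
    {p : LTerm ⊕ LSub → ℂ} (hp : Pattern p) : Pattern (p * idxW u) := by
  obtain ⟨D, hD⟩ := hp.bounded
  have h : Pattern (idxW fun n => p (.inl (.idx n)) * u n) := .idx (C := D * C) fun n => by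
    rw [norm_mul]
    exact mul_le_mul (hD _) (hu n) (norm_nonneg _) ((norm_nonneg _).trans (hD (.inr .shift)))
  convert h using 1
  funext x
  rcases x with (_ | _ | _ | _) | (_ | _ | _) <;> simp [idxW]

theorem Pattern.mul_shift {p : LTerm ⊕ LSub → ℂ} (c : ℂ) : Pattern (p * shiftW c) := by
  convert Pattern.shift (p (.inr .shift) * c) using 1
  funext x
  rcases x with (_ | _ | _ | _) | (_ | _ | _) <;> simp [shiftW]

theorem appW_zero : appW 0 = 0 := by
  funext x
  rcases x with (_ | _ | _ | _) | (_ | _ | _) <;> rfl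

theorem appW_add (h₁ h₂ : LTerm → LTerm → ℂ) : appW (h₁ + h₂) = appW h₁ + appW h₂ := by
  funext x
  rcases x with (_ | _ | _ | _) | (_ | _ | _) <;> simp [appW]

theorem closW_zero : closW 0 = 0 := by
  funext x
  rcases x with (_ | _ | _ | _) | (_ | _ | _) <;> rfl

theorem closW_add (h₁ h₂ : LTerm → LSub → ℂ) : closW (h₁ + h₂) = closW h₁ + closW h₂ := by
  funext x
  rcases x with (_ | _ | _ | _) | (_ | _ | _) <;> simp [closW]

theorem Pattern.appW_of_tens {h : LTerm → LTerm → ℂ} (hh : Tens TermPattern TermPattern h) :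
    Pattern (appW h) := by
  induction hh with
  | zero => rw [appW_zero]; exact .zero
  | add _ _ ih₁ ih₂ => rw [appW_add]; exact ih₁.add ih₂
  | mul hf hg =>
    obtain ⟨f', hf', ef⟩ := hf
    obtain ⟨g', hg', eg⟩ := hg
    simp only [ef, eg]
    exact .app hf' hg'

theorem Pattern.closW_of_tens {h : LTerm → LSub → ℂ} (hh : Tens TermPattern SubPattern h) :
    Pattern (closW h) := by
  induction hh with
  | zero => rw [closW_zero]; exact .zero
  | add _ _ ih₁ ih₂ => rw [closW_add]; exact ih₁.add ih₂
  | mul hf hg =>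
    obtain ⟨f', hf', ef⟩ := hf
    obtain ⟨g', hg', eg⟩ := hg
    simp only [ef, eg]
    exact .clos hf' hg'

/-- Multiplying a sum of products by a fixed product. -/
theorem Tens.mul_right {α β : Type} {A A' : (α → ℂ) → Prop} {B B' : (β → ℂ) → Prop}
    {h : α → β → ℂ} (hh : Tens A B h) {f : α → ℂ} {g : β → ℂ}
    (hf : ∀ p, A p → A' (p * f)) (hg : ∀ q, B q → B' (q * g)) :
    Tens A' B' (fun a b => h a b * (f a * g b)) := by
  induction hh with
  | zero => exact Tens.zero.congr (by simp)
  | add _ _ ih₁ ih₂ => exact (ih₁.add ih₂).congr fun a b => by simp [add_mul]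
  | mul hp hq => exact (Tens.mul (hf _ hp) (hg _ hq)).congr fun a b => by simp; ring

theorem TermPattern.mul_of {f : LTerm ⊕ LSub → ℂ} (ih : ∀ g, Pattern g → Pattern (g * f)) :
    ∀ p, TermPattern p → TermPattern (p * fun t => f (.inl t)) := by
  rintro p ⟨g, hg, e⟩
  exact ⟨g * f, ih g hg, fun t => by simp [e]⟩

theorem SubPattern.mul_of {f : LTerm ⊕ LSub → ℂ} (ih : ∀ g, Pattern g → Pattern (g * f)) :
    ∀ p, SubPattern p → SubPattern (p * fun t => f (.inr t)) := by
  rintro p ⟨g, hg, e⟩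
  exact ⟨g * f, ih g hg, fun t => by simp [e]⟩

theorem Pattern.mul_app {f g : LTerm ⊕ LSub → ℂ}
    (ihf : ∀ p, Pattern p → Pattern (p * f)) (ihg : ∀ p, Pattern p → Pattern (p * g))
    {p : LTerm ⊕ LSub → ℂ} (hp : Pattern p) :
    Pattern (p * appW fun a b => f (.inl a) * g (.inl b)) := by
  convert appW_of_tens (hp.heads.2.1.mul_right (TermPattern.mul_of ihf)
    (TermPattern.mul_of ihg)) using 1
  funext x
  rcases x with (_ | _ | _ | _) | (_ | _ | _) <;> simp [appW]

theorem Pattern.mul_clos {f g : LTerm ⊕ LSub → ℂ}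
    (ihf : ∀ p, Pattern p → Pattern (p * f)) (ihg : ∀ p, Pattern p → Pattern (p * g))
    {p : LTerm ⊕ LSub → ℂ} (hp : Pattern p) :
    Pattern (p * closW fun a s => f (.inl a) * g (.inr s)) := by
  convert closW_of_tens (hp.heads.2.2.1.mul_right (TermPattern.mul_of ihf)
    (SubPattern.mul_of ihg)) using 1
  funext x
  rcases x with (_ | _ | _ | _) | (_ | _ | _) <;> simp [closW]

theorem Pattern.mul_norm {k : ℕ} {n : ℕ → ℕ} {p q : ℕ → ℕ → LTerm ⊕ LSub → ℂ}
    (hp : ∀ j l, Pattern (p j l)) (hq : ∀ j l, Pattern (q j l))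
    (h : ∀ j ≤ k, ∀ u v, normInd j (.inl (.clos u v)) =
        ∑ l ∈ Finset.range (n j), p j l (.inl u) * q j l (.inr v))
    (ihp : ∀ j l, ∀ g, Pattern g → Pattern (g * p j l))
    (ihq : ∀ j l, ∀ g, Pattern g → Pattern (g * q j l))
    {g : LTerm ⊕ LSub → ℂ} (hg : Pattern g) :
    ∀ j ≤ k, Pattern (g * normInd j) := by
  have hN : ∀ {j}, j ≤ k → Pattern (normInd j) := fun hj => norm_of_le hp hq h hj
  induction hg with
  | one => intro j hj; simpa using hN hj
  | add _ _ ih₁ ih₂ => intro j hj; rw [add_mul]; exact (ih₁ j hj).add (ih₂ j hj)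
  | idx hu => intro j hj; rw [mul_comm]; exact (hN hj).mul_idx hu
  | @lam f _ ih =>
    intro j hj
    convert (ih j hj).lam using 1
    funext x
    rcases x with (_ | _ | _ | _) | (_ | _ | _) <;> simp [lamW, normInd_lam]
  | @app f g _ _ ih₁ ih₂ =>
    intro j hj
    have ht : Tens TermPattern TermPattern (fun a b => normInd j (.inl (.app a b)) *
        (f (.inl a) * g (.inl b))) := by
      refine (Tens.sum (s := Finset.HasAntidiagonal.antidiagonal j) (h := fun x a b =>
        (f * normInd x.1) (.inl a) * (g * normInd x.2) (.inl b)) fun x hx => ?_).congr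
        fun a b => ?_
      · rw [Finset.HasAntidiagonal.mem_antidiagonal] at hx
        exact .mul (ih₁ _ (by omega)).termPattern (ih₂ _ (by omega)).termPattern
      · simp only [normInd_app, Finset.sum_mul, Finset.sum_apply, Pi.mul_apply]
        exact Finset.sum_congr rfl fun _ _ => by ring
    convert appW_of_tens ht using 1
    funext x
    rcases x with (_ | _ | _ | _) | (_ | _ | _) <;> simp [appW, mul_comm]
  | @clos f g hf hg _ _ =>
    intro j hj
    have ht : Tens TermPattern SubPattern (fun a s => normInd j (.inl (.clos a s)) *
        (f (.inl a) * g (.inr s))) := by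
      refine (Tens.sum (s := Finset.range (n j)) (h := fun l a s =>
        (f * p j l) (.inl a) * (g * q j l) (.inr s)) fun l _ => ?_).congr fun a s => ?_
      · exact .mul (ihp j l f hf).termPattern (ihq j l g hg).subPattern
      · simp only [h j hj, Finset.sum_mul, Finset.sum_apply, Pi.mul_apply]
        exact Finset.sum_congr rfl fun _ _ => by ring
    convert closW_of_tens ht using 1
    funext x
    rcases x with (_ | _ | _ | _) | (_ | _ | _) <;> simp [closW, mul_comm]
  | slash | lift | shift =>
    intro j hj
    convert Pattern.zero using 1
    funext x
    rcases x with (_ | _ | _ | _) | (_ | _ | _) <;> simp [slashW, liftW, shiftW, normInd]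
  | norm i n' p' q' hp' hq' h' =>
    intro j hj
    by_cases hij : i = j
    · rw [hij, normInd_mul_self]; exact hN hj
    · rw [normInd_mul_of_ne hij]; exact .zero

theorem Pattern.mul {f g : LTerm ⊕ LSub → ℂ} (hg : Pattern g) (hf : Pattern f) :
    Pattern (g * f) := by
  induction hf generalizing g with
  | one => simpa using hg
  | add _ _ ih₁ ih₂ => rw [mul_add]; exact (ih₁ hg).add (ih₂ hg)
  | idx hu => exact hg.mul_idx hu
  | lam _ ih => exact mul_lam (fun _ => ih) hg
  | app _ _ ih₁ ih₂ => exact mul_app (fun _ => ih₁) (fun _ => ih₂) hg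
  | clos _ _ ih₁ ih₂ => exact mul_clos (fun _ => ih₁) (fun _ => ih₂) hg
  | slash _ ih => exact mul_slash (fun _ => ih) hg
  | lift _ ih => exact mul_lift (fun _ => ih) hg
  | shift c => exact mul_shift c
  | norm k n p q hp hq h ihp ihq =>
    exact mul_norm hp hq h (fun j l _ => ihp j l) (fun j l _ => ihq j l) hg k le_rfl

theorem SubPattern.mul {f g : LSub → ℂ} (hf : SubPattern f) (hg : SubPattern g) :
    SubPattern (f * g) := by
  obtain ⟨f', hf', ef⟩ := hf
  obtain ⟨g', hg', eg⟩ := hg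
  exact ⟨f' * g', hf'.mul hg', fun s => by simp [ef, eg]⟩

/-- The weight equal to `h` on closures of applications and vanishing elsewhere. -/
def redexApp (h : LTerm → LTerm → LSub → ℂ) : LTerm → LSub → ℂ
  | .app a b, s => h a b s
  | _, _ => 0

/-- The weight equal to `h` on closures of abstractions and vanishing elsewhere. -/
def redexLam (h : LTerm → LSub → ℂ) : LTerm → LSub → ℂ
  | .lam a, s => h a s
  | _, _ => 0

/-- The weight equal to `h` on closures of indices and vanishing elsewhere. -/
def redexIdx (h : ℕ → LSub → ℂ) : LTerm → LSub → ℂ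
  | .idx n, s => h n s
  | _, _ => 0

/-- The weight equal to `h` on closures of closures and vanishing elsewhere. -/
def redexClos (h : LTerm → LSub → LSub → ℂ) : LTerm → LSub → ℂ
  | .clos a s, s' => h a s s'
  | _, _ => 0

theorem tens_redexLam {h : LTerm → LSub → ℂ} (hh : Tens TermPattern SubPattern h) :
    Tens TermPattern SubPattern (redexLam h) := by
  induction hh with
  | zero => exact Tens.zero.congr fun u v => by cases u <;> rfl
  | add _ _ ih₁ ih₂ => exact (ih₁.add ih₂).congr fun u v => by cases u <;> simp [redexLam]
  | mul hf hg =>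
    obtain ⟨f, hf, e⟩ := hf
    exact (Tens.mul hf.lam.termPattern hg).congr fun u v => by
      cases u <;> simp [redexLam, lamW, e]

theorem tens_redexApp {h₁ h₂ : LTerm → LSub → ℂ} (hh₁ : Tens TermPattern SubPattern h₁)
    (hh₂ : Tens TermPattern SubPattern h₂) :
    Tens TermPattern SubPattern (redexApp fun a b s => h₁ a s * h₂ b s) := by
  induction hh₁ with
  | zero => exact Tens.zero.congr fun u v => by cases u <;> simp [redexApp]
  | add _ _ ih₁ ih₂ =>
    exact (ih₁.add ih₂).congr fun u v => by cases u <;> simp [redexApp, add_mul]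
  | @mul f g hf hg =>
    induction hh₂ with
    | zero => exact Tens.zero.congr fun u v => by cases u <;> simp [redexApp]
    | add _ _ ih₁ ih₂ =>
      exact (ih₁.add ih₂).congr fun u v => by cases u <;> simp [redexApp, mul_add]
    | mul hf' hg' =>
      obtain ⟨f, hf, e⟩ := hf
      obtain ⟨f', hf', e'⟩ := hf'
      refine (Tens.mul (hf.app hf').termPattern (hg.mul hg')).congr fun u v => ?_
      cases u <;> simp [redexApp, appW, e, e']
      ring

theorem tens_redexClos {h : LTerm → LSub → ℂ} (hh : Tens TermPattern SubPattern h)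
    {q : LSub → ℂ} (hq : SubPattern q) :
    Tens TermPattern SubPattern (redexClos fun a s s' => h a s * q s') := by
  induction hh with
  | zero => exact Tens.zero.congr fun u v => by cases u <;> simp [redexClos]
  | add _ _ ih₁ ih₂ =>
    exact (ih₁.add ih₂).congr fun u v => by cases u <;> simp [redexClos, add_mul]
  | mul hf hg =>
    obtain ⟨f, hf, e⟩ := hf
    obtain ⟨g, hg, e'⟩ := hg
    exact (Tens.mul (hf.clos hg).termPattern hq).congr fun u v => by
      cases u <;> simp [redexClos, closW, e, e']

theorem Tens.lift_right {h : LTerm → LSub → ℂ} (hh : Tens TermPattern SubPattern h) :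
    Tens TermPattern SubPattern fun u v => h u (.lift v) := by
  induction hh with
  | zero => exact .zero
  | add _ _ ih₁ ih₂ => exact ih₁.add ih₂
  | mul hf hg =>
    obtain ⟨g, hg, e⟩ := hg
    simp only [e]
    exact .mul hf hg.heads.2.2.2.2

/-- The contribution of the rules `App`. -/
theorem Tens.contract_app {h : LTerm → LTerm → ℂ} (hh : Tens TermPattern TermPattern h) :
    Tens TermPattern SubPattern
      (redexApp fun a b s => h (.clos a s) (.clos b s)) := by
  induction hh with
  | zero => exact Tens.zero.congr fun u v => by cases u <;> simp [redexApp]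
  | add _ _ ih₁ ih₂ =>
    exact (ih₁.add ih₂).congr fun u v => by cases u <;> simp [redexApp]
  | mul hf hg =>
    obtain ⟨f, hf, e⟩ := hf
    obtain ⟨g, hg, e'⟩ := hg
    simp only [e, e']
    exact tens_redexApp hf.heads.2.2.1 hg.heads.2.2.1

/-- A bounded weight on indices times a pattern on substitutions. -/
theorem tens_redexIdx {u : ℕ → ℂ} {C : ℝ} (hu : ∀ n, ‖u n‖ ≤ C) {q : LSub → ℂ}
    (hq : SubPattern q) : Tens TermPattern SubPattern (redexIdx fun n s => u n * q s) :=
  (Tens.mul (Pattern.idx hu).termPattern hq).congr fun u v => by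
    cases u <;> simp [redexIdx, idxW]

/-- The sequence `c, 0, 0, …` is bounded by `‖c‖`. -/
theorem norm_atZero_le (c : ℂ) (n : ℕ) : ‖if n = 0 then c else 0‖ ≤ ‖c‖ := by
  split_ifs <;> simp

theorem norm_shiftSeq_le {u : ℕ → ℂ} {C : ℝ} (hu : ∀ n, ‖u n‖ ≤ C) (n : ℕ) :
    ‖if n = 0 then 0 else u (n - 1)‖ ≤ C := by
  split_ifs
  · simpa using (norm_nonneg _).trans (hu 0)
  · exact hu _

/-- The substitutions reached by `RVarLift`. -/
theorem Tens.contract_rvarLift {h : LTerm → LSub → ℂ} (hh : Tens TermPattern SubPattern h) :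
    Tens TermPattern SubPattern (redexIdx fun n s => match n, s with
      | n + 1, .lift s => h (.clos (.idx n) s) .shift
      | _, _ => 0) := by
  induction hh with
  | zero =>
    exact Tens.zero.congr fun u v => by
      rcases u with (_ | _) | _ | _ | _ <;> cases v <;> simp [redexIdx]
  | add _ _ ih₁ ih₂ =>
    exact (ih₁.add ih₂).congr fun u v => by
      rcases u with (_ | _) | _ | _ | _ <;> cases v <;> simp [redexIdx]
  | @mul f g hf hg =>
    obtain ⟨f, hf, e⟩ := hf
    simp only [e]
    have key : ∀ {h : LTerm → LSub → ℂ}, Tens TermPattern SubPattern h →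
        Tens TermPattern SubPattern (redexIdx fun n s => match n, s with
          | n + 1, .lift s => h (.idx n) s * g .shift
          | _, _ => 0) := by
      intro h hh
      induction hh with
      | zero =>
        exact Tens.zero.congr fun u v => by
          rcases u with (_ | _) | _ | _ | _ <;> cases v <;> simp [redexIdx]
      | add _ _ ih₁ ih₂ =>
        exact (ih₁.add ih₂).congr fun u v => by
          rcases u with (_ | _) | _ | _ | _ <;> cases v <;> simp [redexIdx, add_mul]
      | @mul p q hp hq =>
        obtain ⟨p, hp, ep⟩ := hp
        obtain ⟨q, hq, eq⟩ := hq
        obtain ⟨C, hC⟩ := hp.bounded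
        have hu : ∀ n, ‖p (.inl (.idx n)) * g .shift‖ ≤ C * ‖g .shift‖ := fun n => by
          rw [norm_mul]
          exact mul_le_mul_of_nonneg_right (hC _) (norm_nonneg _)
        refine (tens_redexIdx (norm_shiftSeq_le hu) hq.lift.subPattern).congr fun u v => ?_
        rcases u with (_ | _) | _ | _ | _ <;> cases v <;>
          simp [redexIdx, liftW, ep, eq]
        ring
    exact key hf.heads.2.2.1

/-- The pullback of a pattern along contraction of a closure is a sum of products of patterns,
provided this holds for the patterns occurring in the bodies of closures. -/
theorem Pattern.contract_of {f : LTerm ⊕ LSub → ℂ} (hf : Pattern f)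
    (hc : Tens TermPattern SubPattern (redexClos fun a s s' =>
      f (.inl (.clos (LTerm.contract (.clos a s)) s')))) :
    Tens TermPattern SubPattern fun u v => f (.inl (LTerm.contract (.clos u v))) := by
  obtain ⟨hlam, happ, hclos, -, -⟩ := hf.heads
  obtain ⟨C, hC⟩ := hf.bounded
  obtain ⟨g, hg, e⟩ := hlam
  have t₁ := happ.contract_app
  have t₂ := tens_redexLam (Tens.lift_right hg.heads.2.2.1)
  have t₃ := tens_redexIdx (norm_atZero_le 1) hf.slash.subPattern
  have t₄ := tens_redexIdx (norm_shiftSeq_le fun n => hC (.inl (.idx n))) one.slash.subPattern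
  have t₅ := tens_redexIdx (norm_atZero_le (f (.inl (.idx 0)))) one.lift.subPattern
  have t₆ := hclos.contract_rvarLift
  have t₇ := tens_redexIdx (fun n => hC (.inl (.idx (n + 1)))) (shift 1).subPattern
  refine (t₁.add <| t₂.add <| t₃.add <| t₄.add <| t₅.add <| t₆.add <| t₇.add hc).congr
    fun u v => ?_
  rcases u with (_ | _) | _ | _ | _ <;> cases v <;>
    simp [redexApp, redexLam, redexIdx, redexClos, slashW, liftW, shiftW, LTerm.contract, e]

theorem Pattern.contract {f : LTerm ⊕ LSub → ℂ} (hf : Pattern f) :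
    Tens TermPattern SubPattern fun u v => f (.inl (LTerm.contract (.clos u v))) := by
  induction hf with
  | one => exact (Tens.mul one.termPattern one.subPattern).congr (by simp)
  | add _ _ ih₁ ih₂ => exact ih₁.add ih₂
  | @clos f g hf hg ih _ =>
    exact (hf.clos hg).contract_of (tens_redexClos ih hg.subPattern)
  | norm k n p q hp hq h ihp _ =>
    refine (norm k n p q hp hq h).contract_of
      ((Tens.sum (s := Finset.range (n k)) fun l _ =>
        tens_redexClos (ihp k l) (hq k l).subPattern).congr fun u v => ?_)
    cases u <;> simp [redexClos, h k le_rfl]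
  | _ =>
    refine contract_of (by constructor <;> assumption) (Tens.zero.congr fun u v => ?_)
    cases u <;> rfl

/-- On closures, the indicators of the terms normalising in a bounded number of steps are sums
of products of patterns. -/
theorem exists_normInd_clos (k : ℕ) : ∃ (n : ℕ → ℕ) (p q : ℕ → ℕ → LTerm ⊕ LSub → ℂ),
    (∀ j l, Pattern (p j l)) ∧ (∀ j l, Pattern (q j l)) ∧
      ∀ j ≤ k, ∀ u v, normInd j (.inl (.clos u v)) =
        ∑ l ∈ Finset.range (n j), p j l (.inl u) * q j l (.inr v) := by
  induction k using Nat.strong_induction_on with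
  | _ k ih =>
    have hT : ∀ j ≤ k, Tens TermPattern SubPattern
        fun u v => normInd j (.inl (.clos u v)) := by
      intro j hj
      cases j with
      | zero => exact Tens.zero.congr fun u v => normInd_zero_clos u v
      | succ j =>
        obtain ⟨n, p, q, hp, hq, h⟩ := ih j (by omega)
        exact (Pattern.norm j n p q hp hq h).contract.congr fun u v => normInd_succ_clos j u v
    choose n p q hp hq h using fun j => (show ∃ (n : ℕ) (p q : ℕ → LTerm ⊕ LSub → ℂ),
      (∀ l, Pattern (p l)) ∧ (∀ l, Pattern (q l)) ∧ (j ≤ k → ∀ u v,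
        normInd j (.inl (.clos u v)) =
          ∑ l ∈ Finset.range n, p l (.inl u) * q l (.inr v)) from by
      by_cases hj : j ≤ k
      · obtain ⟨n, p, q, hp, hq, h⟩ := (hT j hj).exists_sum
        exact ⟨n, p, q, hp, hq, fun _ => h⟩
      · exact ⟨0, 0, 0, fun _ => .zero, fun _ => .zero, fun h => absurd h hj⟩)
    exact ⟨n, p, q, hp, hq, h⟩


/-- Terms are indices, abstractions, applications or closures. -/
def LTerm.headEquiv : ℕ ⊕ LTerm ⊕ (LTerm × LTerm) ⊕ (LTerm × LSub) ≃ LTerm where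
  toFun
    | .inl n => .idx n
    | .inr (.inl a) => .lam a
    | .inr (.inr (.inl x)) => .app x.1 x.2
    | .inr (.inr (.inr x)) => .clos x.1 x.2
  invFun
    | .idx n => .inl n
    | .lam a => .inr (.inl a)
    | .app a b => .inr (.inr (.inl (a, b)))
    | .clos a s => .inr (.inr (.inr (a, s)))
  left_inv := by rintro (_ | _ | _ | _) <;> rfl
  right_inv := by rintro (_ | _ | _ | _) <;> rfl

/-- Substitutions are of the form `a/`, lifted, or the shift. -/
def LSub.headEquiv : LTerm ⊕ LSub ⊕ Unit ≃ LSub where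
  toFun
    | .inl a => .slash a
    | .inr (.inl s) => .lift s
    | .inr (.inr _) => .shift
  invFun
    | .slash a => .inl a
    | .lift s => .inr (.inl s)
    | .shift => .inr (.inr ())
  left_inv := by rintro (_ | _ | _) <;> rfl
  right_inv := by rintro (_ | _ | _) <;> rfl

open scoped ENNReal

theorem ennreal_tsum_lterm (F : LTerm → ℝ≥0∞) : ∑' t, F t = ∑' n, F (.idx n) +
    (∑' a, F (.lam a) + (∑' x : LTerm × LTerm, F (.app x.1 x.2) +
      ∑' x : LTerm × LSub, F (.clos x.1 x.2))) := by
  rw [← LTerm.headEquiv.tsum_eq, Summable.tsum_sum ENNReal.summable ENNReal.summable,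
    Summable.tsum_sum ENNReal.summable ENNReal.summable,
    Summable.tsum_sum ENNReal.summable ENNReal.summable]
  rfl

theorem ennreal_tsum_lsub (F : LSub → ℝ≥0∞) : ∑' s, F s = ∑' a, F (.slash a) +
    (∑' s, F (.lift s) + F .shift) := by
  rw [← LSub.headEquiv.tsum_eq, Summable.tsum_sum ENNReal.summable ENNReal.summable,
    Summable.tsum_sum ENNReal.summable ENNReal.summable, tsum_fintype (β := Unit)]
  simp [LSub.headEquiv]

theorem tsum_lterm {F : LTerm → ℂ} (hF : Summable F) : ∑' t, F t = ∑' n, F (.idx n) +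
    (∑' a, F (.lam a) + (∑' x : LTerm × LTerm, F (.app x.1 x.2) +
      ∑' x : LTerm × LSub, F (.clos x.1 x.2))) := by
  rw [← LTerm.headEquiv.tsum_eq]
  replace hF := LTerm.headEquiv.summable_iff.2 hF
  have h₁ := hF.comp_injective Sum.inr_injective
  have h₂ := h₁.comp_injective Sum.inr_injective
  have e₁ := Summable.tsum_sum (hF.comp_injective Sum.inl_injective) h₁
  have e₂ := Summable.tsum_sum (h₁.comp_injective Sum.inl_injective) h₂
  have e₃ := Summable.tsum_sum (h₂.comp_injective Sum.inl_injective)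
    (h₂.comp_injective Sum.inr_injective)
  exact e₁.trans (congrArg₂ _ rfl (e₂.trans (congrArg₂ _ rfl e₃)))

theorem tsum_lsub {F : LSub → ℂ} (hF : Summable F) : ∑' s, F s = ∑' a, F (.slash a) +
    (∑' s, F (.lift s) + F .shift) := by
  rw [← LSub.headEquiv.tsum_eq]
  replace hF := LSub.headEquiv.summable_iff.2 hF
  have h₁ := hF.comp_injective Sum.inr_injective
  have e₁ := Summable.tsum_sum (hF.comp_injective Sum.inl_injective) h₁
  have e₂ := Summable.tsum_sum (h₁.comp_injective Sum.inl_injective)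
    (h₁.comp_injective Sum.inr_injective)
  exact e₁.trans (congrArg₂ _ rfl (e₂.trans (congrArg₂ _ rfl
    ((tsum_fintype _).trans (by simp; rfl)))))

theorem ennreal_tsum_le_of_trunc {α : Type} (size : α → ℕ) (F : α → ℝ≥0∞) {c : ℝ≥0∞}
    (h : ∀ n, ∑' t, (if size t < n then F t else 0) ≤ c) : ∑' t, F t ≤ c := by
  rw [ENNReal.tsum_eq_iSup_sum]
  refine iSup_le fun s => le_trans ?_ (h (s.sup size + 1))
  refine le_trans (Finset.sum_le_sum fun t ht => ?_) (ENNReal.sum_le_tsum s)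
  rw [if_pos (Nat.lt_succ_of_le (Finset.le_sup ht))]

theorem ennreal_tsum_prod_mul {α β : Type} (f : α → ℝ≥0∞) (g : β → ℝ≥0∞) :
    ∑' x : α × β, f x.1 * g x.2 = (∑' a, f a) * ∑' b, g b := by
  rw [ENNReal.tsum_prod (f := fun a b => f a * g b)]
  simp only [ENNReal.tsum_mul_left, ENNReal.tsum_mul_right]

theorem summable_of_ennreal_tsum_le {α : Type} {F : α → ℝ} (h0 : ∀ a, 0 ≤ F a) {c : ℝ}
    (hc : 0 ≤ c) (h : ∑' a, ENNReal.ofReal (F a) ≤ ENNReal.ofReal c) :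
    Summable F ∧ ∑' a, F a ≤ c := by
  have hs : Summable F := by
    convert ENNReal.summable_toReal (h.trans_lt ENNReal.ofReal_lt_top).ne using 1
    funext a
    rw [ENNReal.toReal_ofReal (h0 a)]
  refine ⟨hs, ?_⟩
  rwa [← ENNReal.ofReal_tsum_of_nonneg h0 hs, ENNReal.ofReal_le_ofReal_iff hc] at h

theorem ennreal_tsum_pow_succ {r : ℝ} (h0 : 0 ≤ r) (h1 : r < 1) :
    ∑' n : ℕ, ENNReal.ofReal r ^ (n + 1) = ENNReal.ofReal (r / (1 - r)) := by
  rw [ENNReal.tsum_geometric_add_one, ← ENNReal.ofReal_one, ← ENNReal.ofReal_sub _ h0,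
    ← ENNReal.ofReal_inv_of_pos (by linarith), ← ENNReal.ofReal_mul h0, div_eq_mul_inv]

/-- Bounds on the truncated generating functions of terms and substitutions propagate along
the grammar. -/
theorem trunc_bound {r x y : ℝ} (hr : 0 ≤ r) (hr1 : r < 1) (hx : 0 ≤ x) (hy : 0 ≤ y)
    (hT : r / (1 - r) + (r * x + (r * (x * x) + r * (x * y))) ≤ x)
    (hS : r * x + (r * y + r) ≤ y) (n : ℕ) :
    ∑' t : LTerm, (if t.size < n then ENNReal.ofReal r ^ t.size else 0) ≤ ENNReal.ofReal x ∧
    ∑' s : LSub, (if s.size < n then ENNReal.ofReal r ^ s.size else 0) ≤ ENNReal.ofReal y := by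
  induction n with
  | zero => simp
  | succ n ih =>
    obtain ⟨ihT, ihS⟩ := ih
    set R := ENNReal.ofReal r
    obtain ⟨G, hG⟩ : ∃ G : LTerm → ℝ≥0∞,
        ∀ t, G t = if t.size < n then R ^ t.size else 0 := ⟨_, fun _ => rfl⟩
    obtain ⟨H, hH⟩ : ∃ H : LSub → ℝ≥0∞,
        ∀ s, H s = if s.size < n then R ^ s.size else 0 := ⟨_, fun _ => rfl⟩
    simp only [← hG] at ihT
    simp only [← hH] at ihS
    constructor
    · rw [ennreal_tsum_lterm]
      refine le_trans (add_le_add (ENNReal.tsum_le_tsum (g := fun m => R ^ (m + 1)) fun m => ?_)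
        (add_le_add (ENNReal.tsum_le_tsum (g := fun a => R * G a) fun a => ?_)
        (add_le_add (ENNReal.tsum_le_tsum (g := fun z => R * (G z.1 * G z.2)) fun z => ?_)
        (ENNReal.tsum_le_tsum (g := fun z => R * (G z.1 * H z.2)) fun z => ?_)))) ?_
      · split_ifs <;> simp [LTerm.size]
      · simp only [hG]
        split_ifs with h₁ h₂
        · rw [LTerm.size, pow_add, pow_one]
        · simp only [LTerm.size] at h₁; omega
        all_goals simp
      · simp only [hG]
        split_ifs with h₁ h₂ h₃ <;> first | (simp only [LTerm.size] at h₁; omega) | skip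
        · rw [LTerm.size, pow_add, pow_add, pow_one, mul_assoc]
        all_goals simp
      · simp only [hG, hH]
        split_ifs with h₁ h₂ h₃ <;> first | (simp only [LTerm.size] at h₁; omega) | skip
        · rw [LTerm.size, pow_add, pow_add, pow_one, mul_assoc]
        all_goals simp
      · rw [ennreal_tsum_pow_succ hr hr1]
        simp only [ENNReal.tsum_mul_left, ennreal_tsum_prod_mul]
        refine le_trans (add_le_add le_rfl (add_le_add (mul_le_mul' le_rfl ihT) (add_le_add
          (mul_le_mul' le_rfl (mul_le_mul' ihT ihT))
          (mul_le_mul' le_rfl (mul_le_mul' ihT ihS))))) ?_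
        have h1r : 0 < 1 - r := by linarith
        rw [← ENNReal.ofReal_mul hx, ← ENNReal.ofReal_mul hx, ← ENNReal.ofReal_mul hr,
          ← ENNReal.ofReal_mul hr, ← ENNReal.ofReal_mul hr,
          ← ENNReal.ofReal_add (by positivity) (by positivity),
          ← ENNReal.ofReal_add (by positivity) (by positivity),
          ← ENNReal.ofReal_add (by positivity) (by positivity)]
        exact ENNReal.ofReal_le_ofReal hT
    · rw [ennreal_tsum_lsub]
      refine le_trans (add_le_add (ENNReal.tsum_le_tsum (g := fun a => R * G a) fun a => ?_)
        (add_le_add (ENNReal.tsum_le_tsum (g := fun s => R * H s) fun a => ?_)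
        (show _ ≤ R from ?_))) ?_
      · simp only [hG]
        split_ifs with h₁ h₂
        · rw [LSub.size, pow_add, pow_one]
        · simp only [LSub.size] at h₁; omega
        all_goals simp
      · simp only [hH]
        split_ifs with h₁ h₂
        · rw [LSub.size, pow_add, pow_one]
        · simp only [LSub.size] at h₁; omega
        all_goals simp
      · split_ifs <;> simp [LSub.size]
      · simp only [ENNReal.tsum_mul_left]
        refine le_trans (add_le_add (mul_le_mul' le_rfl ihT)
          (add_le_add (mul_le_mul' le_rfl ihS) le_rfl)) ?_
        rw [← ENNReal.ofReal_mul hr, ← ENNReal.ofReal_mul hr,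
          ← ENNReal.ofReal_add (by positivity) (by positivity),
          ← ENNReal.ofReal_add (by positivity) (by positivity)]
        exact ENNReal.ofReal_le_ofReal hS

open Classical in
/-- Bounds on the truncated generating function of pure terms propagate along the grammar. -/
theorem trunc_bound_pure {r x : ℝ} (hr : 0 ≤ r) (hr1 : r < 1) (hx : 0 ≤ x)
    (hT : r / (1 - r) + (r * x + r * (x * x)) ≤ x) (n : ℕ) :
    ∑' t : LTerm, (if t.size < n then (if t.IsPure then ENNReal.ofReal r ^ t.size else 0) else 0)
      ≤ ENNReal.ofReal x := by
  induction n with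
  | zero => simp
  | succ n ih =>
    set R := ENNReal.ofReal r
    simp only [← ite_and] at ih ⊢
    obtain ⟨G, hG⟩ : ∃ G : LTerm → ℝ≥0∞,
        ∀ t, G t = if t.size < n ∧ t.IsPure then R ^ t.size else 0 := ⟨_, fun _ => rfl⟩
    simp only [← hG] at ih
    rw [ennreal_tsum_lterm]
    refine le_trans (add_le_add (ENNReal.tsum_le_tsum (g := fun m => R ^ (m + 1)) fun m => ?_)
      (add_le_add (ENNReal.tsum_le_tsum (g := fun a => R * G a) fun a => ?_)
      (add_le_add (ENNReal.tsum_le_tsum (g := fun z => R * (G z.1 * G z.2)) fun z => ?_)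
      (ENNReal.tsum_le_tsum (g := fun _ => 0) fun z => ?_)))) ?_
    · split_ifs <;> simp [LTerm.size]
    · by_cases h : (LTerm.lam a).size < n + 1 ∧ (LTerm.lam a).IsPure
      · have h' : a.size < n ∧ a.IsPure := by
          simp only [LTerm.size, LTerm.IsPure] at h; exact ⟨by omega, h.2⟩
        rw [hG, if_pos h, if_pos h', LTerm.size, pow_add, pow_one]
      · rw [if_neg h]; exact zero_le
    · by_cases h : (LTerm.app z.1 z.2).size < n + 1 ∧ (LTerm.app z.1 z.2).IsPure
      · have h₁ : z.1.size < n ∧ z.1.IsPure := by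
          simp only [LTerm.size, LTerm.IsPure] at h; exact ⟨by omega, h.2.1⟩
        have h₂ : z.2.size < n ∧ z.2.IsPure := by
          simp only [LTerm.size, LTerm.IsPure] at h; exact ⟨by omega, h.2.2⟩
        rw [hG, hG, if_pos h, if_pos h₁, if_pos h₂, LTerm.size, pow_add, pow_add, pow_one, mul_assoc]
      · rw [if_neg h]; exact zero_le
    · simp [LTerm.IsPure]
    · rw [ennreal_tsum_pow_succ hr hr1]
      simp only [ENNReal.tsum_mul_left, ennreal_tsum_prod_mul, tsum_zero, add_zero]
      refine le_trans (add_le_add le_rfl (add_le_add (mul_le_mul' le_rfl ih)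
        (mul_le_mul' le_rfl (mul_le_mul' ih ih)))) ?_
      have h1r : 0 < 1 - r := by linarith
      rw [← ENNReal.ofReal_mul hx, ← ENNReal.ofReal_mul hr, ← ENNReal.ofReal_mul hr,
        ← ENNReal.ofReal_add (by positivity) (by positivity),
        ← ENNReal.ofReal_add (by positivity) (by positivity)]
      exact ENNReal.ofReal_le_ofReal hT

theorem summable_lterm : Summable (fun t : LTerm => (1 / 4 : ℝ) ^ t.size) ∧
    ∑' t : LTerm, (1 / 4 : ℝ) ^ t.size ≤ 1 := by
  refine summable_of_ennreal_tsum_le (fun t => by positivity) zero_le_one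
    (ennreal_tsum_le_of_trunc LTerm.size _ fun n => ?_)
  simp only [ENNReal.ofReal_pow (show (0 : ℝ) ≤ 1 / 4 by norm_num)]
  exact (trunc_bound (y := 2 / 3) (by norm_num) (by norm_num) (by norm_num) (by norm_num)
    (by norm_num) (by norm_num) n).1

theorem summable_lsub : Summable (fun s : LSub => (1 / 4 : ℝ) ^ s.size) := by
  refine (summable_of_ennreal_tsum_le (c := 2 / 3) (fun t => by positivity) (by norm_num)
    (ennreal_tsum_le_of_trunc LSub.size _ fun n => ?_)).1
  simp only [ENNReal.ofReal_pow (show (0 : ℝ) ≤ 1 / 4 by norm_num)]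
  exact (trunc_bound (x := 1) (by norm_num) (by norm_num) (by norm_num) (by norm_num)
    (by norm_num) (by norm_num) n).2

theorem summable_pure : Summable (fun t : LTerm => ‖normInd 0 (.inl t)‖ * (7 / 25 : ℝ) ^ t.size) ∧
    ∑' t : LTerm, ‖normInd 0 (.inl t)‖ * (7 / 25 : ℝ) ^ t.size ≤ 1 := by
  classical
  refine summable_of_ennreal_tsum_le (fun t => by positivity) zero_le_one
    (ennreal_tsum_le_of_trunc LTerm.size _ fun n => ?_)
  convert trunc_bound_pure (r := 7 / 25) (x := 1) (by norm_num) (by norm_num) (by norm_num)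
    (by norm_num) n using 5 with t
  by_cases h : t.IsPure
  · rw [← ENNReal.ofReal_pow (by norm_num)]
    simp [normInd, normIn_zero, h]
  · simp [normInd, normIn_zero, h]
/-- The generating function of terms with weight `f`. -/
noncomputable def gfT (f : LTerm ⊕ LSub → ℂ) (z : ℂ) : ℂ := ∑' t : LTerm, f (.inl t) * z ^ t.size

/-- The generating function of substitutions with weight `f`. -/
noncomputable def gfS (f : LTerm ⊕ LSub → ℂ) (z : ℂ) : ℂ := ∑' s : LSub, f (.inr s) * z ^ s.size

theorem summable_norm_mul_pow {α : Type} {size : α → ℕ} {r : ℝ}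
    (h : Summable fun a => r ^ size a) {f : α → ℂ} {C : ℝ} (hf : ∀ a, ‖f a‖ ≤ C) {z : ℂ}
    (hz : ‖z‖ ≤ r) : Summable fun a => ‖f a * z ^ size a‖ := by
  refine Summable.of_nonneg_of_le (fun _ => norm_nonneg _) (fun a => ?_) (h.mul_left C)
  rw [norm_mul, norm_pow]
  exact mul_le_mul (hf a) (pow_le_pow_left₀ (norm_nonneg z) hz _) (by positivity)
    ((norm_nonneg _).trans (hf a))

theorem tsum_finset_sum_mul {ι α β : Type} (s : Finset ι) {F : ι → α → ℂ} {G : ι → β → ℂ}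
    (hF : ∀ i ∈ s, Summable fun a => ‖F i a‖) (hG : ∀ i ∈ s, Summable fun b => ‖G i b‖) :
    ∑' x : α × β, ∑ i ∈ s, F i x.1 * G i x.2 = ∑ i ∈ s, (∑' a, F i a) * ∑' b, G i b := by
  rw [Summable.tsum_finsetSum fun i hi => summable_mul_of_summable_norm (hF i hi) (hG i hi)]
  exact Finset.sum_congr rfl fun i hi =>
    (tsum_mul_tsum_of_summable_norm (hF i hi) (hG i hi)).symm

theorem analyticOnNhd_tsum_mul_pow {α : Type} {size : α → ℕ} {f : α → ℂ} {r : ℝ}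
    (h : Summable fun a => ‖f a‖ * r ^ size a) :
    AnalyticOnNhd ℂ (fun z => ∑' a, f a * z ^ size a) (Metric.ball 0 r) := by
  refine DifferentiableOn.analyticOnNhd ?_ Metric.isOpen_ball
  refine Complex.differentiableOn_tsum_of_summable_norm h (fun a => by fun_prop)
    Metric.isOpen_ball fun a w hw => ?_
  rw [norm_mul, norm_pow]
  rw [mem_ball_zero_iff] at hw
  gcongr

namespace Pattern

variable {f g : LTerm ⊕ LSub → ℂ} {z : ℂ}

theorem summable_term (hf : Pattern f) (hz : ‖z‖ < 1 / 4) :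
    Summable fun t : LTerm => ‖f (.inl t) * z ^ t.size‖ :=
  hf.bounded.elim fun _ hC => summable_norm_mul_pow summable_lterm.1 (fun _ => hC _) hz.le

theorem summable_sub (hf : Pattern f) (hz : ‖z‖ < 1 / 4) :
    Summable fun s : LSub => ‖f (.inr s) * z ^ s.size‖ :=
  hf.bounded.elim fun _ hC => summable_norm_mul_pow summable_lsub (fun _ => hC _) hz.le

theorem gfT_eq (hf : Pattern f) (hz : ‖z‖ < 1 / 4) : gfT f z =
    ∑' n, f (.inl (.idx n)) * z ^ (n + 1) + (z * ∑' a : LTerm, f (.inl (.lam a)) * z ^ a.size +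
      (z * ∑' x : LTerm × LTerm, f (.inl (.app x.1 x.2)) * (z ^ x.1.size * z ^ x.2.size) +
        z * ∑' x : LTerm × LSub, f (.inl (.clos x.1 x.2)) * (z ^ x.1.size * z ^ x.2.size))) := by
  rw [gfT, tsum_lterm (hf.summable_term hz).of_norm]
  simp only [← tsum_mul_left]
  refine congrArg₂ _ rfl (congrArg₂ _ ?_ (congrArg₂ _ ?_ ?_)) <;>
    refine tsum_congr fun a => ?_ <;> simp only [LTerm.size] <;> ring

theorem gfS_eq (hf : Pattern f) (hz : ‖z‖ < 1 / 4) : gfS f z =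
    z * ∑' a : LTerm, f (.inr (.slash a)) * z ^ a.size +
      (z * ∑' s : LSub, f (.inr (.lift s)) * z ^ s.size + f (.inr .shift) * z) := by
  rw [gfS, tsum_lsub (hf.summable_sub hz).of_norm]
  simp only [← tsum_mul_left]
  refine congrArg₂ _ ?_ (congrArg₂ _ ?_ ?_)
  · refine tsum_congr fun a => ?_
    simp only [LSub.size]; ring
  · refine tsum_congr fun a => ?_
    simp only [LSub.size]; ring
  · simp only [LSub.size, pow_one]

end Pattern

/-- Functions on the disc `‖z‖ < 1/4` of the form `√(1 - 4z) P(z) + Q(z)`, with `P` and `Q`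
analytic on a fixed larger disc. -/
def SqrtRep (φ : ℂ → ℂ) : Prop :=
  ∃ P Q : ℂ → ℂ, AnalyticOnNhd ℂ P (Metric.ball 0 (7 / 25)) ∧
    AnalyticOnNhd ℂ Q (Metric.ball 0 (7 / 25)) ∧
    ∀ z : ℂ, ‖z‖ < 1 / 4 → φ z = (1 - 4 * z) ^ ((1 : ℂ) / 2) * P z + Q z

namespace SqrtRep

variable {φ ψ : ℂ → ℂ}

theorem congr (h : SqrtRep φ) (e : ∀ z : ℂ, ‖z‖ < 1 / 4 → ψ z = φ z) : SqrtRep ψ := by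
  obtain ⟨P, Q, hP, hQ, hφ⟩ := h
  exact ⟨P, Q, hP, hQ, fun z hz => (e z hz).trans (hφ z hz)⟩

theorem of_analytic (h : AnalyticOnNhd ℂ φ (Metric.ball 0 (7 / 25))) : SqrtRep φ :=
  ⟨0, φ, analyticOnNhd_const, h, fun z _ => by simp⟩

theorem add (h : SqrtRep φ) (h' : SqrtRep ψ) : SqrtRep fun z => φ z + ψ z := by
  obtain ⟨P, Q, hP, hQ, hφ⟩ := h
  obtain ⟨P', Q', hP', hQ', hψ⟩ := h'
  refine ⟨P + P', Q + Q', hP.add hP', hQ.add hQ', fun z hz => ?_⟩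
  simp only [hφ z hz, hψ z hz, Pi.add_apply]
  ring

theorem mul (h : SqrtRep φ) (h' : SqrtRep ψ) : SqrtRep fun z => φ z * ψ z := by
  obtain ⟨P, Q, hP, hQ, hφ⟩ := h
  obtain ⟨P', Q', hP', hQ', hψ⟩ := h'
  have hs : AnalyticOnNhd ℂ (fun z : ℂ => 1 - 4 * z) (Metric.ball 0 (7 / 25)) :=
    fun z _ => by fun_prop
  refine ⟨P * Q' + Q * P', (fun z => 1 - 4 * z) * (P * P') + Q * Q',
    (hP.mul hQ').add (hQ.mul hP'), (hs.mul (hP.mul hP')).add (hQ.mul hQ'), fun z hz => ?_⟩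
  have hsq : ((1 - 4 * z) ^ ((1 : ℂ) / 2)) ^ 2 = 1 - 4 * z := by
    rw [one_div]; exact_mod_cast Complex.cpow_nat_inv_pow (1 - 4 * z) two_ne_zero
  simp only [hφ z hz, hψ z hz, Pi.add_apply, Pi.mul_apply]
  linear_combination P z * P' z * hsq

theorem sum {ι : Type} {s : Finset ι} {φ : ι → ℂ → ℂ} (h : ∀ i ∈ s, SqrtRep (φ i)) :
    SqrtRep fun z => ∑ i ∈ s, φ i z := by
  classical
  induction s using Finset.induction_on with
  | empty => exact of_analytic analyticOnNhd_const
  | insert a s ha ih =>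
    rw [Finset.forall_mem_insert] at h
    exact (h.1.add (ih h.2)).congr fun z _ => Finset.sum_insert ha

theorem of_mul {w : ℂ → ℂ} (hw : AnalyticOnNhd ℂ w (Metric.ball 0 (7 / 25)))
    (h0 : ∀ z ∈ Metric.ball (0 : ℂ) (7 / 25), w z ≠ 0) (h : SqrtRep ψ)
    (e : ∀ z : ℂ, ‖z‖ < 1 / 4 → φ z * w z = ψ z) : SqrtRep φ := by
  refine (h.mul (of_analytic (hw.inv h0))).congr fun z hz => ?_
  have hz' : z ∈ Metric.ball (0 : ℂ) (7 / 25) := by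
    rw [mem_ball_zero_iff]; linarith
  rw [← e z hz, Pi.inv_apply, mul_inv_cancel_right₀ (h0 z hz')]

theorem id : SqrtRep fun z => z := of_analytic analyticOnNhd_id

end SqrtRep

theorem sqrtRep_idx {u : ℕ → ℂ} {C : ℝ} (hu : ∀ n, ‖u n‖ ≤ C) :
    SqrtRep fun z => ∑' n, u n * z ^ (n + 1) := by
  refine .of_analytic (analyticOnNhd_tsum_mul_pow (size := fun n => n + 1) ?_)
  refine Summable.of_nonneg_of_le (fun n => by positivity)
    (fun n => mul_le_mul_of_nonneg_right (hu n) (by positivity)) (Summable.mul_left C ?_)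
  exact (summable_nat_add_iff 1).2 (summable_geometric_of_lt_one (by norm_num) (by norm_num))

/-- The generating functions of all terms and of all substitutions. -/
theorem sqrtRep_one : SqrtRep (fun z => z * gfT 1 z) ∧ SqrtRep (gfS 1) := by
  have hS : ∀ z : ℂ, ‖z‖ < 1 / 4 → gfS 1 z * (1 - z) = z * gfT 1 z + z := by
    intro z hz
    have h := Pattern.one.gfS_eq hz
    simp only [Pi.one_apply] at h
    have h₁ : ∑' a : LTerm, 1 * z ^ a.size = gfT 1 z := rfl
    have h₂ : ∑' s : LSub, 1 * z ^ s.size = gfS 1 z := rfl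
    rw [h₁, h₂] at h
    linear_combination h
  have hT : ∀ z : ℂ, ‖z‖ < 1 / 4 → gfT 1 z = z * (1 + gfT 1 z) ^ 2 := by
    intro z hz
    have h := Pattern.one.gfT_eq hz
    have hs := hS z hz
    have s₁ := Pattern.one.summable_term hz
    have s₂ := Pattern.one.summable_sub hz
    have e₁ := tsum_mul_tsum_of_summable_norm s₁ s₁
    have e₂ := tsum_mul_tsum_of_summable_norm s₁ s₂
    simp only [Pi.one_apply, one_mul] at h e₁ e₂
    rw [← e₁, ← e₂] at h
    have h₁ : ∑' a : LTerm, z ^ a.size = gfT 1 z := by simp [gfT]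
    have h₂ : ∑' s : LSub, z ^ s.size = gfS 1 z := by simp [gfS]
    have h₃ : (∑' n : ℕ, z ^ (n + 1)) * (1 - z) = z := by
      have hz1 : 1 - z ≠ 0 := by
        intro h0
        rw [← sub_eq_zero.1 h0] at hz
        norm_num at hz
      simp only [pow_succ]
      rw [tsum_mul_right, tsum_geometric_of_norm_lt_one (by linarith)]
      field_simp
    rw [h₁, h₂] at h
    linear_combination (1 - z) * h + h₃ + z * gfT 1 z * hs
  have hzT : SqrtRep fun z => z * gfT 1 z := by
    refine ⟨fun _ => -(1 / 2), fun z => 1 / 2 - z, analyticOnNhd_const,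
      analyticOnNhd_const.sub analyticOnNhd_id, fun z hz => ?_⟩
    have hsq : (1 - 2 * z * (1 + gfT 1 z)) ^ 2 = 1 - 4 * z := by
      linear_combination -4 * z * hT z hz
    have hn : ‖gfT 1 z‖ ≤ 1 := by
      refine (tsum_of_norm_bounded summable_lterm.1.hasSum fun t => ?_).trans summable_lterm.2
      rw [Pi.one_apply, one_mul, norm_pow]
      exact pow_le_pow_left₀ (norm_nonneg z) hz.le _
    have hre : 0 < (1 - 2 * z * (1 + gfT 1 z)).re := by
      have h₁ : ‖2 * z * (1 + gfT 1 z)‖ < 1 := by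
        have h₂ : ‖1 + gfT 1 z‖ ≤ 2 := (norm_add_le _ _).trans (by rw [norm_one]; linarith)
        rw [norm_mul, norm_mul, Complex.norm_ofNat]
        nlinarith [norm_nonneg z, norm_nonneg (1 + gfT 1 z)]
      have h₂ := (Complex.abs_re_le_norm _).trans_lt h₁
      rw [Complex.sub_re, Complex.one_re]
      linarith [le_abs_self (2 * z * (1 + gfT 1 z)).re]
    have hroot := Complex.sq_cpow_two_inv hre
    rw [hsq] at hroot
    rw [one_div, hroot]
    ring
  refine ⟨hzT, .of_mul (w := fun z => 1 - z) (analyticOnNhd_const.sub analyticOnNhd_id)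
    (fun z hz h0 => ?_) (hzT.add .id) hS⟩
  rw [← sub_eq_zero.1 h0] at hz
  norm_num at hz

/-- The generating function of the terms normalising in exactly `j` steps, provided those which
are closures are described by weights of the required form. -/
theorem sqrtRep_normInd {k : ℕ} {n : ℕ → ℕ} {p q : ℕ → ℕ → LTerm ⊕ LSub → ℂ}
    (hp : ∀ j l, Pattern (p j l)) (hq : ∀ j l, Pattern (q j l))
    (h : ∀ j ≤ k, ∀ u v, normInd j (.inl (.clos u v)) =
      ∑ l ∈ Finset.range (n j), p j l (.inl u) * q j l (.inr v))
    (hP : ∀ j l, SqrtRep fun z => z * gfT (p j l) z) (hQ : ∀ j l, SqrtRep (gfS (q j l)))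
    {j : ℕ} (hj : j ≤ k) : SqrtRep (gfT (normInd j)) := by
  have hL : AnalyticOnNhd ℂ (gfT (normInd 0)) (Metric.ball 0 (7 / 25)) :=
    analyticOnNhd_tsum_mul_pow (size := LTerm.size) (f := fun t => normInd 0 (.inl t))
      summable_pure.1
  induction j using Nat.strong_induction_on with
  | _ j ih =>
    cases j with
    | zero => exact .of_analytic hL
    | succ m =>
      refine .of_mul (w := fun z => 1 - z - 2 * z * gfT (normInd 0) z)
        (ψ := fun z => z * ∑ x ∈ (Finset.HasAntidiagonal.antidiagonal m).erase (m, 0),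
            gfT (normInd (x.1 + 1)) z * gfT (normInd x.2) z +
          ∑ l ∈ Finset.range (n (m + 1)), z * gfT (p (m + 1) l) z * gfS (q (m + 1) l) z)
        ?_ (fun z hz h0 => ?_) ?_ fun z hz => ?_
      · exact (analyticOnNhd_const.sub analyticOnNhd_id).sub
          ((analyticOnNhd_const.mul analyticOnNhd_id).mul hL)
      · rw [mem_ball_zero_iff] at hz
        have hn : ‖gfT (normInd 0) z‖ ≤ 1 := by
          refine (tsum_of_norm_bounded summable_pure.1.hasSum fun t => ?_).trans summable_pure.2
          rw [norm_mul, norm_pow]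
          gcongr
        have h₁ : (1 : ℂ) = z + 2 * z * gfT (normInd 0) z := by linear_combination h0
        have h₂ := congrArg norm h₁
        have h₃ := norm_add_le z (2 * z * gfT (normInd 0) z)
        rw [← h₂, norm_one, norm_mul, norm_mul, Complex.norm_ofNat] at h₃
        nlinarith [norm_nonneg z, norm_nonneg (gfT (normInd 0) z)]
      · refine .add (.mul .id (.sum fun x hx => ?_)) (.sum fun l _ => (hP _ l).mul (hQ _ l))
        rw [Finset.mem_erase, Finset.HasAntidiagonal.mem_antidiagonal] at hx
        have hx1 : x.1 ≠ m := fun e => hx.1 (Prod.ext e (by have := hx.2; simp; omega))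
        exact (ih _ (by omega) (by omega)).mul (ih _ (by omega) (by omega))
      · have e := (Pattern.norm_of_le hp hq h hj).gfT_eq hz
        have e₀ : ∀ n : ℕ, normInd (m + 1) (.inl (.idx n)) * z ^ (n + 1) = 0 := by
          intro n; rw [normInd_idx]; simp
        have e₁ : ∑' x : LTerm × LTerm, normInd (m + 1) (.inl (.app x.1 x.2)) *
            (z ^ x.1.size * z ^ x.2.size) = ∑ x ∈ Finset.HasAntidiagonal.antidiagonal (m + 1),
              gfT (normInd x.1) z * gfT (normInd x.2) z := by
          simp only [gfT]
          rw [← tsum_finset_sum_mul]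
          · refine tsum_congr fun x => ?_
            rw [normInd_app, Finset.sum_mul]
            exact Finset.sum_congr rfl fun i _ => by ring
          all_goals
            intro x hx
            rw [Finset.HasAntidiagonal.mem_antidiagonal] at hx
            exact (Pattern.norm_of_le hp hq h (by omega)).summable_term hz
        have e₂ : ∑' x : LTerm × LSub, normInd (m + 1) (.inl (.clos x.1 x.2)) *
            (z ^ x.1.size * z ^ x.2.size) = ∑ l ∈ Finset.range (n (m + 1)),
              gfT (p (m + 1) l) z * gfS (q (m + 1) l) z := by
          simp only [gfT, gfS]
          rw [← tsum_finset_sum_mul _ (fun l _ => (hp _ l).summable_term hz)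
            fun l _ => (hq _ l).summable_sub hz]
          refine tsum_congr fun x => ?_
          rw [h _ hj, Finset.sum_mul]
          exact Finset.sum_congr rfl fun i _ => by ring
        have e₃ : ∑' a : LTerm, normInd (m + 1) (.inl (.lam a)) * z ^ a.size =
            gfT (normInd (m + 1)) z := by simp only [normInd_lam, gfT]
        simp only [e₀, tsum_zero] at e
        rw [e₁, e₂, e₃, Finset.Nat.sum_antidiagonal_succ, ← Finset.add_sum_erase
          (Finset.HasAntidiagonal.antidiagonal m) _ (a := (m, 0)) (by simp)] at e
        simp only [mul_assoc, ← Finset.mul_sum]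
        linear_combination e

/-- The generating functions attached to patterns. -/
theorem Pattern.sqrtRep {f : LTerm ⊕ LSub → ℂ} (hf : Pattern f) :
    SqrtRep (fun z => z * gfT f z) ∧ SqrtRep (gfS f) := by
  have h0 : SqrtRep fun _ => 0 := .of_analytic analyticOnNhd_const
  induction hf with
  | one => exact sqrtRep_one
  | @add f g hf hg ihf ihg =>
    refine ⟨(ihf.1.add ihg.1).congr fun z hz => ?_, (ihf.2.add ihg.2).congr fun z hz => ?_⟩
    · have e := (hf.summable_term hz).of_norm.tsum_add (hg.summable_term hz).of_norm
      simp only [gfT, ← mul_add, ← e, Pi.add_apply, add_mul]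
    · have e := (hf.summable_sub hz).of_norm.tsum_add (hg.summable_sub hz).of_norm
      simp only [gfS, ← e, Pi.add_apply, add_mul]
  | idx hu =>
    refine ⟨(SqrtRep.id.mul (sqrtRep_idx hu)).congr fun z hz => ?_, h0.congr fun z hz => ?_⟩
    · rw [(idx hu).gfT_eq hz]; simp [idxW]
    · simp [gfS, idxW]
  | lam hf ih =>
    refine ⟨(SqrtRep.id.mul ih.1).congr fun z hz => ?_, h0.congr fun z hz => ?_⟩
    · rw [hf.lam.gfT_eq hz]; simp [lamW, gfT]
    · simp [gfS, lamW]
  | app hf hg ihf ihg =>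
    refine ⟨(ihf.1.mul ihg.1).congr fun z hz => ?_, h0.congr fun z hz => ?_⟩
    · have e := tsum_mul_tsum_of_summable_norm (hf.summable_term hz) (hg.summable_term hz)
      rw [(hf.app hg).gfT_eq hz]
      simp only [appW, zero_mul, tsum_zero, mul_mul_mul_comm _ _ (z ^ _), ← e, gfT]
      ring
    · simp [gfS, appW]
  | clos hf hg ihf ihg =>
    refine ⟨(SqrtRep.id.mul (ihf.1.mul ihg.2)).congr fun z hz => ?_, h0.congr fun z hz => ?_⟩
    · have e := tsum_mul_tsum_of_summable_norm (hf.summable_term hz) (hg.summable_sub hz)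
      rw [(hf.clos hg).gfT_eq hz]
      simp only [closW, zero_mul, tsum_zero, mul_mul_mul_comm _ _ (z ^ _), ← e, gfT, gfS]
      ring
    · simp [gfS, closW]
  | slash hf ih =>
    refine ⟨h0.congr fun z hz => ?_, ih.1.congr fun z hz => ?_⟩
    · simp [gfT, slashW]
    · rw [hf.slash.gfS_eq hz]; simp [slashW, gfT]
  | lift hf ih =>
    refine ⟨h0.congr fun z hz => ?_, (SqrtRep.id.mul ih.2).congr fun z hz => ?_⟩
    · simp [gfT, liftW]
    · rw [hf.lift.gfS_eq hz]; simp [liftW, gfS]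
  | shift c =>
    refine ⟨h0.congr fun z hz => ?_,
      ((SqrtRep.of_analytic (analyticOnNhd_const (v := c))).mul .id).congr fun z hz => ?_⟩
    · simp [gfT, shiftW]
    · rw [(shift c).gfS_eq hz]; simp [shiftW]
  | norm k n p q hp hq h ihp ihq =>
    refine ⟨SqrtRep.id.mul (sqrtRep_normInd hp hq h (fun j l => (ihp j l).1)
      (fun j l => (ihq j l).2) le_rfl), h0.congr fun z hz => ?_⟩
    simp [gfS, normInd]

theorem hasSum_normCount {k : ℕ} {z : ℂ}
    (h : Summable fun t : LTerm => normInd k (.inl t) * z ^ t.size) :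
    HasSum (fun n : ℕ => (normCount k n : ℂ) * z ^ n) (gfT (normInd k) z) := by
  classical
  have e : ∀ (n : ℕ) (t : LTerm), Set.indicator (LTerm.size ⁻¹' {n})
      (fun t => normInd k (.inl t) * z ^ t.size) t =
        Set.indicator {t | t.size = n ∧ NormIn t k} (fun _ => z ^ n) t := by
    intro n t
    by_cases h₁ : t.size = n <;> by_cases h₂ : NormIn t k <;>
      simp [normInd, h₁, h₂]
  have e' : ∀ n : ℕ, ∑' t : LTerm.size ⁻¹' {n}, normInd k (.inl t.1) * z ^ t.1.size =
      (normCount k n : ℂ) * z ^ n := by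
    intro n
    rw [tsum_subtype (LTerm.size ⁻¹' {n}) fun t => normInd k (.inl t) * z ^ t.size,
      tsum_congr (e n), ← tsum_subtype, tsum_const, nsmul_eq_mul]
    rfl
  have e'' := h.hasSum.tsum_fiberwise LTerm.size
  simp only [e'] at e''
  exact e''

/-- For each k ≥ 1 the generating function G_k(z) = ∑_n g_n^{(k)} z^n can be
represented as √(1 − 4z)·P(z) + Q(z) with P, Q analytic in a disc
|z| < 1/4 + ε for some ε > 0; in particular G_k is analytic at 0 with a unique
dominant singularity at z = 1/4 of square-root type. -/
theorem Gk_singularity_representation (k : ℕ) (hk : 1 ≤ k) :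
    ∃ ε : ℝ, 0 < ε ∧
      ∃ P Q : ℂ → ℂ,
        AnalyticOnNhd ℂ P (Metric.ball 0 (1/4 + ε)) ∧
        AnalyticOnNhd ℂ Q (Metric.ball 0 (1/4 + ε)) ∧
        ∀ z : ℂ, ‖z‖ < 1/4 →
          HasSum (fun n : ℕ => (normCount k n : ℂ) * z ^ n)
            ((1 - 4*z) ^ ((1 : ℂ)/2) * P z + Q z) := by
  obtain ⟨n, p, q, hp, hq, h⟩ := exists_normInd_clos k
  obtain ⟨P, Q, hP, hQ, e⟩ := sqrtRep_normInd hp hq h (fun j l => (hp j l).sqrtRep.1)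
    (fun j l => (hq j l).sqrtRep.2) le_rfl
  have hr : (1 : ℝ) / 4 + 3 / 100 = 7 / 25 := by norm_num
  refine ⟨3 / 100, by norm_num, P, Q, hr ▸ hP, hr ▸ hQ, fun z hz => ?_⟩
  rw [← e z hz]
  exact hasSum_normCount ((Pattern.norm k n p q hp hq h).summable_term hz).of_norm
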